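/- Let X be a semi-simplicial set and Simp(X) its simplex category, with objects pairs (p, x) for x ∈ X_p and morphisms (p,x) → (q,y) the injective order-preserving maps φ : [p] → [q] with φ*y = x. Then there is a natural zig-zag of weak homotopy equivalences between the classifying space B Simp(X) and the fat geometric realisation ‖X‖. -/

import Mathlib

open CategoryTheory

universe u v

/-- A semi-simplicial set: a contravariant functor on nonempty finite linear orders and
injective monotone maps. -/
structure SemiSimplicialSet : Type (u + 1) where
  obj : ℕ → Type u
  map : ∀ {m n : ℕ} (φ : Fin (m + 1) →o Fin (n + 1)),
    Function.Injective ⇑φ → obj n → obj m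
  map_id : ∀ (n : ℕ) (h : Function.Injective ⇑(OrderHom.id : Fin (n + 1) →o Fin (n + 1)))
    (x : obj n), map OrderHom.id h x = x
  map_comp : ∀ {k m n : ℕ} (φ : Fin (k + 1) →o Fin (m + 1)) (ψ : Fin (m + 1) →o Fin (n + 1))
    (hφ : Function.Injective ⇑φ) (hψ : Function.Injective ⇑ψ)
    (h : Function.Injective ⇑(ψ.comp φ)) (x : obj n),
    map φ hφ (map ψ hψ x) = map (ψ.comp φ) h x

/-- The standard topological `n`-simplex. -/
def topStdSimplex (n : ℕ) : Type :=
  {u : Fin (n + 1) → ℝ // (∀ i, 0 ≤ u i) ∧ ∑ i, u i = 1}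

instance (n : ℕ) : TopologicalSpace (topStdSimplex n) :=
  inferInstanceAs (TopologicalSpace {u : Fin (n + 1) → ℝ // (∀ i, 0 ≤ u i) ∧ ∑ i, u i = 1})

/-- Pushforward of a point of the standard simplex along a monotone map of index sets. -/
def pushStd {m n : ℕ} (φ : Fin (m + 1) →o Fin (n + 1)) (u : topStdSimplex m) : topStdSimplex n :=
  ⟨fun j => ∑ i ∈ Finset.univ.filter (fun i => φ i = j), u.1 i, by
    refine ⟨fun j => Finset.sum_nonneg fun i _ => u.2.1 i, ?_⟩
    show (∑ j, ∑ i ∈ Finset.univ.filter (fun i => φ i = j), u.1 i) = 1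
    rw [Finset.sum_fiberwise]
    exact u.2.2⟩

/-- The disjoint union `⨿ₙ Xₙ × Δⁿ` (with each `Xₙ` discrete). -/
def SimplexTotal (X : SemiSimplicialSet.{u}) : Type u :=
  Σ n : ℕ, X.obj n × topStdSimplex n

instance (X : SemiSimplicialSet.{u}) : TopologicalSpace (SimplexTotal X) :=
  letI : ∀ n, TopologicalSpace (X.obj n) := fun _ => ⊥
  inferInstanceAs (TopologicalSpace (Σ n : ℕ, X.obj n × topStdSimplex n))

/-- The gluing relation defining the fat geometric realisation. -/
inductive FatRel (X : SemiSimplicialSet.{u}) : SimplexTotal X → SimplexTotal X → Prop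
  | glue {m n : ℕ} (φ : Fin (m + 1) →o Fin (n + 1)) (hφ : Function.Injective ⇑φ)
      (x : X.obj n) (u : topStdSimplex m) :
      FatRel X ⟨m, (X.map φ hφ x, u)⟩ ⟨n, (x, pushStd φ u)⟩

/-- The fat geometric realisation `‖X‖` of a semi-simplicial set. -/
def FatRealization (X : SemiSimplicialSet.{u}) : Type u :=
  Quot (FatRel X)

instance (X : SemiSimplicialSet.{u}) : TopologicalSpace (FatRealization X) :=
  inferInstanceAs (TopologicalSpace (Quot (FatRel X)))

/-- The nerve of a category, as a semi-simplicial set (its `n`-simplices are strings of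
`n` composable arrows). -/
def nerveSS (C : Type u) [Category.{v} C] : SemiSimplicialSet.{max u v} where
  obj n := ComposableArrows C n
  map φ _ F := φ.monotone.functor ⋙ F
  map_id := fun _ _ _ => rfl
  map_comp := fun _ _ _ _ _ _ => rfl

/-- The classifying space of a category: the fat realisation of its nerve. -/
def ClassifyingSpace (C : Type u) [Category.{v} C] : Type (max u v) :=
  FatRealization (nerveSS C)

instance (C : Type u) [Category.{v} C] : TopologicalSpace (ClassifyingSpace C) :=
  inferInstanceAs (TopologicalSpace (FatRealization (nerveSS C)))


open unitInterval

/-- Composition of a generalized loop with a continuous map. -/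
def pushLoop {X Y : Type*} [TopologicalSpace X] [TopologicalSpace Y] {N : Type*} (f : C(X, Y))
    {x : X} (γ : GenLoop N X x) : GenLoop N Y (f x) :=
  ⟨f.comp γ.1, fun y hy => by
    show f (γ.1 y) = f x
    rw [γ.2 y hy]⟩

/-- A continuous map is a weak homotopy equivalence if it induces a bijection on path
components and on all homotopy groups at all basepoints. -/
def IsWeakHomotopyEquiv {X Y : Type*} [TopologicalSpace X] [TopologicalSpace Y]
    (f : C(X, Y)) : Prop :=
  (∀ y : Y, ∃ x : X, Joined (f x) y) ∧
  (∀ x₀ x₁ : X, Joined (f x₀) (f x₁) → Joined x₀ x₁) ∧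
  (∀ (n : ℕ) (x : X) (γ : GenLoop (Fin (n + 1)) Y (f x)),
      ∃ δ : GenLoop (Fin (n + 1)) X x, GenLoop.Homotopic (pushLoop f δ) γ) ∧
  (∀ (n : ℕ) (x : X) (δ₀ δ₁ : GenLoop (Fin (n + 1)) X x),
      GenLoop.Homotopic (pushLoop f δ₀) (pushLoop f δ₁) → GenLoop.Homotopic δ₀ δ₁)

/-- The objects of the simplex category of a semi-simplicial set: pairs `(p, x)` with
`x ∈ X_p`. -/
def SimpObj (X : SemiSimplicialSet.{u}) : Type u :=
  Σ n : ℕ, X.obj n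

/-- The simplex category `Simp(X)`: morphisms `(p, x) → (q, y)` are injective monotone maps
`φ : [p] → [q]` with `φ* y = x`. -/
instance simpCategory (X : SemiSimplicialSet.{u}) : Category (SimpObj X) where
  Hom a b := {φ : Fin (a.1 + 1) →o Fin (b.1 + 1) //
    ∃ h : Function.Injective ⇑φ, X.map φ h b.2 = a.2}
  id a := ⟨OrderHom.id, fun _ _ h => h, X.map_id a.1 (fun _ _ h => h) a.2⟩
  comp {a b c} f g := ⟨g.1.comp f.1, by
    obtain ⟨hf, hf'⟩ := f.2
    obtain ⟨hg, hg'⟩ := g.2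
    exact ⟨hg.comp hf, by rw [← X.map_comp f.1 g.1 hf hg (hg.comp hf) c.2, hg', hf']⟩⟩
  id_comp := by intro a b f; apply Subtype.ext; rfl
  comp_id := by intro a b f; apply Subtype.ext; rfl
  assoc := by intro a b c d f g h; apply Subtype.ext; rfl

noncomputable section

/-! ### Weights on finite posets -/

open scoped Classical in
/-- Pushforward of a weight function along a map. -/
def pushWeight {A B : Type*} [Fintype A] (φ : A → B) (w : A → ℝ) : B → ℝ :=
  fun b => ∑ a, if φ a = b then w a else 0

section pushWeight

variable {A B C : Type*} [Fintype A]

theorem pushStd_val {m n : ℕ} (φ : Fin (m + 1) →o Fin (n + 1)) (u : topStdSimplex m) :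
    (pushStd φ u).1 = pushWeight φ u.1 := by
  funext j
  simp only [pushStd, pushWeight, Finset.sum_filter]
  exact Finset.sum_congr rfl fun i _ => by congr

theorem sum_pushWeight_mul [Fintype B] (φ : A → B) (w : A → ℝ) (f : B → ℝ) :
    ∑ b, pushWeight φ w b * f b = ∑ a, w a * f (φ a) := by
  classical
  simp only [pushWeight, Finset.sum_mul, ite_mul, zero_mul]
  rw [Finset.sum_comm]
  simp

theorem sum_pushWeight [Fintype B] (φ : A → B) (w : A → ℝ) : ∑ b, pushWeight φ w b = ∑ a, w a := by
  simpa using sum_pushWeight_mul φ w fun _ => 1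

theorem pushWeight_pushWeight [Fintype B] (φ : A → B) (ψ : B → C) (w : A → ℝ) :
    pushWeight ψ (pushWeight φ w) = pushWeight (ψ ∘ φ) w := by
  classical
  funext c
  have h := sum_pushWeight_mul φ w fun b => if ψ b = c then 1 else 0
  simpa [pushWeight, mul_ite] using h

theorem pushWeight_id (w : A → ℝ) : pushWeight id w = w := by
  classical
  funext a
  simp [pushWeight]

theorem pushWeight_combination (φ : A → B) (r s : ℝ) (w w' : A → ℝ) :
    pushWeight φ (fun a => r * w a + s * w' a) =
      fun b => r * pushWeight φ w b + s * pushWeight φ w' b := by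
  classical
  funext b
  simp only [pushWeight, Finset.mul_sum, ← Finset.sum_add_distrib]
  exact Finset.sum_congr rfl fun a _ => by split_ifs <;> simp

theorem pushWeight_apply_of_injective {φ : A → B} (hφ : Function.Injective φ) (w : A → ℝ) (a : A) :
    pushWeight φ w (φ a) = w a := by
  classical
  simp [pushWeight, hφ.eq_iff]

theorem pushWeight_nonneg (φ : A → B) {w : A → ℝ} (hw : ∀ a, 0 ≤ w a) (b : B) :
    0 ≤ pushWeight φ w b := by
  classical
  exact Finset.sum_nonneg fun a _ => by split_ifs <;> simp [hw a]

theorem exists_of_pushWeight_ne_zero {φ : A → B} {w : A → ℝ} {b : B} (h : pushWeight φ w b ≠ 0) :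
    ∃ a, φ a = b ∧ w a ≠ 0 := by
  classical
  obtain ⟨a, -, ha⟩ := Finset.exists_ne_zero_of_sum_ne_zero h
  by_cases hab : φ a = b
  · exact ⟨a, hab, by simpa [hab] using ha⟩
  · simp [hab] at ha

theorem continuous_pushWeight (φ : A → B) : Continuous (pushWeight φ) := by
  classical
  refine continuous_pi fun b => continuous_finsetSum _ fun a _ => ?_
  split_ifs
  · exact continuous_apply a
  · exact continuous_const

end pushWeight

/-- The geometric realisation of the order complex of a finite poset: barycentric weights whose
support is a chain. -/
def chainWeights (J : Type*) [Fintype J] [PartialOrder J] : Set (J → ℝ) :=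
  {w | (∀ j, 0 ≤ w j) ∧ ∑ j, w j = 1 ∧ ∀ i j, w i ≠ 0 → w j ≠ 0 → i ≤ j ∨ j ≤ i}

section chainWeights

variable {J K : Type*} [Fintype J] [PartialOrder J] [Fintype K] [PartialOrder K]

theorem topStdSimplex_mem_chainWeights {n : ℕ} (v : topStdSimplex n) :
    v.1 ∈ chainWeights (Fin (n + 1)) :=
  ⟨v.2.1, v.2.2, fun i j _ _ => le_total i j⟩

theorem pushWeight_mem_chainWeights {g : J → K} (hg : Monotone g) {w : J → ℝ}
    (hw : w ∈ chainWeights J) : pushWeight g w ∈ chainWeights K := by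
  refine ⟨pushWeight_nonneg g hw.1, (sum_pushWeight g w).trans hw.2.1, fun i j hi hj => ?_⟩
  obtain ⟨a, rfl, ha⟩ := exists_of_pushWeight_ne_zero hi
  obtain ⟨b, rfl, hb⟩ := exists_of_pushWeight_ne_zero hj
  exact (hw.2.2 a b ha hb).imp (fun h => hg h) fun h => hg h

/-- Pushforward of chain weights along a monotone map. -/
def pushChain {g : J → K} (hg : Monotone g) (w : chainWeights J) : chainWeights K :=
  ⟨pushWeight g w.1, pushWeight_mem_chainWeights hg w.2⟩

theorem pushChain_pushChain {L : Type*} [Fintype L] [PartialOrder L] {g : J → K} (hg : Monotone g)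
    {h : K → L} (hh : Monotone h) (w : chainWeights J) :
    pushChain hh (pushChain hg w) = pushChain (hh.comp hg) w :=
  Subtype.ext (pushWeight_pushWeight g h w.1)

theorem continuous_pushChain {g : J → K} (hg : Monotone g) : Continuous (pushChain hg) :=
  Continuous.subtype_mk ((continuous_pushWeight g).comp continuous_subtype_val) _

/-- A point of the standard simplex, as a weight on its vertices. -/
def vertexWeights {n : ℕ} (v : topStdSimplex n) : chainWeights (Fin (n + 1)) :=
  ⟨v.1, topStdSimplex_mem_chainWeights v⟩

theorem continuous_vertexWeights {n : ℕ} : Continuous (vertexWeights (n := n)) :=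
  Continuous.subtype_mk continuous_subtype_val _

theorem vertexWeights_pushStd {m n : ℕ} (φ : Fin (m + 1) →o Fin (n + 1)) (v : topStdSimplex m) :
    vertexWeights (pushStd φ v) = pushChain φ.monotone (vertexWeights v) :=
  Subtype.ext (pushStd_val φ v)

theorem exists_pushWeight_eq {w : J → ℝ} (hw : w ∈ chainWeights J) :
    ∃ (n : ℕ) (g : Fin (n + 1) →o J) (v : topStdSimplex n), Function.Injective g ∧
      (∀ i, v.1 i ≠ 0) ∧ pushWeight g v.1 = w := by
  classical
  let A := {j // w j ≠ 0}
  let _ : LinearOrder A :=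
    { (inferInstance : PartialOrder A) with
      le_total := fun i j => hw.2.2 i j i.2 j.2
      toDecidableLE := Classical.decRel _ }
  have hA : Nonempty A := by
    by_contra h
    have : ∀ j, w j = 0 := fun j => by
      by_contra hj
      exact h ⟨⟨j, hj⟩⟩
    simpa [this] using hw.2.1
  obtain ⟨n, hn⟩ : ∃ n, Fintype.card A = n + 1 :=
    Nat.exists_eq_succ_of_ne_zero Fintype.card_ne_zero
  let e := monoEquivOfFin A hn
  have key : ∀ f : J → ℝ, ∑ i, w (e i) * f (e i) = ∑ j, w j * f j := fun f => by
    refine Fintype.sum_of_injective (fun i => (e i).1) (Subtype.val_injective.comp e.injective) _ _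
      (fun j hj => ?_) fun _ => rfl
    by_cases h : w j = 0
    · simp [h]
    · exact (hj ⟨e.symm ⟨j, h⟩, by simp⟩).elim
  refine ⟨n, ⟨fun i => (e i).1, fun i j h => e.monotone h⟩,
    ⟨fun i => w (e i), fun i => hw.1 _, by simpa [hw.2.1] using key fun _ => 1⟩,
    fun i j h => e.injective (Subtype.ext h), fun i => (e i).2, ?_⟩
  funext j
  simpa [pushWeight] using! key fun k => if k = j then 1 else 0

theorem isCompact_chainWeights : IsCompact (chainWeights J) := by
  classical
  refine (isCompact_stdSimplex ℝ J).of_isClosed_subset ?_ fun w hw => ⟨hw.1, hw.2.1⟩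
  have : chainWeights J = (⋂ j, {w | 0 ≤ w j}) ∩ {w | ∑ j, w j = 1} ∩
      ⋂ i, ⋂ j, {w | w i = 0 ∨ w j = 0 ∨ i ≤ j ∨ j ≤ i} := by
    ext w
    simp only [chainWeights, Set.mem_ofPred_eq, Set.mem_inter_iff, Set.mem_iInter, and_assoc]
    refine and_congr_right fun _ => and_congr_right fun _ => forall₂_congr fun i j => ?_
    tauto
  rw [this]
  refine ((isClosed_iInter fun j => isClosed_le continuous_const (continuous_apply j)).inter
    (isClosed_eq (by fun_prop) continuous_const)).inter
    (isClosed_iInter fun i => isClosed_iInter fun j => ?_)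
  exact (isClosed_eq (continuous_apply i) continuous_const).union
    ((isClosed_eq (continuous_apply j) continuous_const).union isClosed_const)

instance : CompactSpace (chainWeights J) := isCompact_iff_compactSpace.1 isCompact_chainWeights

end chainWeights

/-! ### Points of a classifying space given by weights on a diagram -/

section weightPoint

variable {D : Type u} [Category.{v} D]

theorem continuous_topStdSimplex_val {n : ℕ} : Continuous fun v : topStdSimplex n => v.1 :=
  continuous_subtype_val

theorem continuous_fatRealization_mk (X : SemiSimplicialSet.{u}) {n : ℕ} (x : X.obj n) :
    Continuous fun v : topStdSimplex n => (Quot.mk (FatRel X) ⟨n, (x, v)⟩ : FatRealization X) := by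
  let _ : ∀ n, TopologicalSpace (X.obj n) := fun _ => ⊥
  have h : Continuous fun v : topStdSimplex n =>
      (⟨n, (x, v)⟩ : Σ n : ℕ, X.obj n × topStdSimplex n) :=
    continuous_sigmaMk.comp (Continuous.prodMk_right x)
  exact continuous_quot_mk.comp h

theorem continuous_fatRealization_lift {X : SemiSimplicialSet.{u}} {Y : Type*} [TopologicalSpace Y]
    {f : SimplexTotal X → Y} (hf : ∀ a b, FatRel X a b → f a = f b)
    (hc : ∀ (n : ℕ) (x : X.obj n), Continuous fun v : topStdSimplex n => f ⟨n, (x, v)⟩) :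
    Continuous (Quot.lift f hf : FatRealization X → Y) := by
  let _ : ∀ n, TopologicalSpace (X.obj n) := fun _ => ⊥
  have : ∀ n, DiscreteTopology (X.obj n) := fun _ => ⟨rfl⟩
  have h : Continuous (X := Σ n : ℕ, X.obj n × topStdSimplex n) f :=
    continuous_sigma fun n => continuous_prod_of_discrete_left.2 (hc n)
  exact continuous_quot_lift hf h

/-- The point of `BD` with given barycentric coordinates in a simplex of the nerve. -/
def nervePoint {n : ℕ} (c : ComposableArrows D n) (v : topStdSimplex n) : ClassifyingSpace D :=
  Quot.mk _ ⟨n, (c, v)⟩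

theorem continuous_nervePoint {n : ℕ} (c : ComposableArrows D n) : Continuous (nervePoint c) :=
  continuous_fatRealization_mk (nerveSS D) c

theorem nervePoint_pushStd {m n : ℕ} (c : ComposableArrows D n) (φ : Fin (m + 1) →o Fin (n + 1))
    (hφ : Function.Injective φ) (v : topStdSimplex m) :
    nervePoint c (pushStd φ v) = nervePoint (φ.monotone.functor ⋙ c) v :=
  (Quot.sound (FatRel.glue (X := nerveSS D) φ hφ c v)).symm

variable {J K : Type*} [PartialOrder J] [PartialOrder K]

theorem nervePoint_congr_of_pos (F : J ⥤ D) {m n : ℕ} {g : Fin (m + 1) →o J} {g' : Fin (n + 1) →o J}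
    (hg : Function.Injective g) (hg' : Function.Injective g') {v : topStdSimplex m}
    {v' : topStdSimplex n} (hv : ∀ i, v.1 i ≠ 0) (hv' : ∀ i, v'.1 i ≠ 0)
    (h : pushWeight g v.1 = pushWeight g' v'.1) :
    nervePoint (g.monotone.functor ⋙ F) v = nervePoint (g'.monotone.functor ⋙ F) v' := by
  have range_eq : ∀ {n : ℕ} {g : Fin (n + 1) →o J} (_ : Function.Injective g)
      {v : topStdSimplex n} (_ : ∀ i, v.1 i ≠ 0), Set.range g = {j | pushWeight g v.1 j ≠ 0} := by
    intro n g hg v hv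
    ext j
    constructor
    · rintro ⟨i, rfl⟩
      simpa [pushWeight_apply_of_injective hg] using hv i
    · intro hj
      obtain ⟨i, hi, -⟩ := exists_of_pushWeight_ne_zero hj
      exact ⟨i, hi⟩
  have hr : Set.range g = Set.range g' := by rw [range_eq hg hv, range_eq hg' hv', h]
  obtain rfl : m = n := by
    have := congrArg Set.ncard hr
    rw [Set.ncard_range_of_injective hg, Set.ncard_range_of_injective hg'] at this
    simpa using this
  obtain rfl : g = g' := by
    ext1
    exact ((g.monotone.strictMono_of_injective hg).range_inj
      (g'.monotone.strictMono_of_injective hg')).1 hr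
  obtain rfl : v = v' := Subtype.ext <| funext fun i => by
    rw [← pushWeight_apply_of_injective hg v.1, h, pushWeight_apply_of_injective hg]
  rfl

theorem nervePoint_congr (F : J ⥤ D) {m n : ℕ} {g : Fin (m + 1) →o J} {g' : Fin (n + 1) →o J}
    (hg : Function.Injective g) (hg' : Function.Injective g') {v : topStdSimplex m}
    {v' : topStdSimplex n} (h : pushWeight g v.1 = pushWeight g' v'.1) :
    nervePoint (g.monotone.functor ⋙ F) v = nervePoint (g'.monotone.functor ⋙ F) v' := by
  have reduce : ∀ {n : ℕ} (v : topStdSimplex n), ∃ (k : ℕ) (φ : Fin (k + 1) →o Fin (n + 1))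
      (u : topStdSimplex k), Function.Injective φ ∧ (∀ i, u.1 i ≠ 0) ∧ pushStd φ u = v := by
    intro n v
    obtain ⟨k, φ, u, hφ, hu, huv⟩ := exists_pushWeight_eq (topStdSimplex_mem_chainWeights v)
    exact ⟨k, φ, u, hφ, hu, Subtype.ext ((pushStd_val φ u).trans huv)⟩
  obtain ⟨k, φ, u, hφ, hu, rfl⟩ := reduce v
  obtain ⟨k', φ', u', hφ', hu', rfl⟩ := reduce v'
  rw [nervePoint_pushStd _ _ hφ, nervePoint_pushStd _ _ hφ']
  rw [pushStd_val, pushStd_val, pushWeight_pushWeight, pushWeight_pushWeight] at h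
  exact nervePoint_congr_of_pos F (g := g.comp φ) (g' := g'.comp φ') (hg.comp hφ) (hg'.comp hφ')
    hu hu' h

variable [Fintype J] [Fintype K]

/-- The point of `BD` determined by a diagram `J ⥤ D` and a weight on `J` supported on a chain. -/
def weightPoint (F : J ⥤ D) (w : chainWeights J) : ClassifyingSpace D :=
  nervePoint ((exists_pushWeight_eq w.2).choose_spec.choose.monotone.functor ⋙ F)
    (exists_pushWeight_eq w.2).choose_spec.choose_spec.choose

theorem weightPoint_eq_nervePoint (F : J ⥤ D) (w : chainWeights J) {n : ℕ} (g : Fin (n + 1) →o J)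
    (hg : Function.Injective g) (v : topStdSimplex n) (h : w.1 = pushWeight g v.1) :
    weightPoint F w = nervePoint (g.monotone.functor ⋙ F) v :=
  have H := (exists_pushWeight_eq w.2).choose_spec.choose_spec.choose_spec
  nervePoint_congr F H.1 hg (H.2.2.trans h)

theorem weightPoint_pushWeight (F : K ⥤ D) {φ : J → K} (hφ : Monotone φ)
    (hφ' : Function.Injective φ) (w : chainWeights J) (w' : chainWeights K)
    (h : w'.1 = pushWeight φ w.1) : weightPoint F w' = weightPoint (hφ.functor ⋙ F) w := by
  obtain ⟨n, g, v, hg, -, hv⟩ := exists_pushWeight_eq w.2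
  rw [weightPoint_eq_nervePoint _ w g hg v hv.symm,
    weightPoint_eq_nervePoint F w' ((⟨φ, hφ⟩ : J →o K).comp g) (hφ'.comp hg) v
      (by rw [h, ← hv, pushWeight_pushWeight]; rfl)]
  rfl

theorem continuous_weightPoint (F : J ⥤ D) : Continuous (weightPoint F) := by
  let G (n : Fin (Fintype.card J)) := {g : Fin (n.1 + 1) →o J // Function.Injective g}
  let S := Σ n : Fin (Fintype.card J), Σ _ : G n, topStdSimplex n.1
  have (n : ℕ) : CompactSpace (topStdSimplex n) :=
    isCompact_iff_compactSpace.1 (isCompact_stdSimplex ℝ (Fin (n + 1)))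
  have (n : Fin (Fintype.card J)) : Finite (G n) :=
    Finite.of_injective (fun g : G n => (g.1 : Fin (n.1 + 1) → J)) fun g g' h =>
      Subtype.ext (DFunLike.coe_injective h)
  let q : S → chainWeights J := fun s =>
    ⟨pushWeight s.2.1.1 s.2.2.1,
      pushWeight_mem_chainWeights s.2.1.1.monotone (topStdSimplex_mem_chainWeights s.2.2)⟩
  have hq : Continuous q := continuous_sigma fun n => continuous_sigma fun g =>
    Continuous.subtype_mk ((continuous_pushWeight g.1).comp continuous_topStdSimplex_val) _
  have hsurj : Function.Surjective q := by
    intro w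
    obtain ⟨n, g, v, hg, -, hv⟩ := exists_pushWeight_eq w.2
    have hn : n < Fintype.card J := by simpa using Fintype.card_le_of_injective g hg
    exact ⟨⟨⟨n, hn⟩, ⟨g, hg⟩, v⟩, Subtype.ext hv⟩
  rw [(hq.isClosedMap.isQuotientMap hq hsurj).continuous_iff]
  refine continuous_sigma fun n => continuous_sigma fun g => ?_
  convert continuous_nervePoint (g.1.monotone.functor ⋙ F) using 1
  funext v
  exact weightPoint_eq_nervePoint F _ g.1 g.2 v rfl

end weightPoint

/-! ### Barycentric subdivision of a simplex -/

instance {n : ℕ} : T2Space (topStdSimplex n) :=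
  inferInstanceAs (T2Space {u : Fin (n + 1) → ℝ // (∀ i, 0 ≤ u i) ∧ ∑ i, u i = 1})

/-- The nonempty faces of the `n`-simplex. -/
abbrev Face (n : ℕ) : Type :=
  {S : Finset (Fin (n + 1)) // S.Nonempty}

/-- The image of a face under a map of simplices. -/
def Face.map {m n : ℕ} (α : Fin (m + 1) → Fin (n + 1)) (S : Face m) : Face n :=
  ⟨S.1.image α, S.2.image α⟩

theorem Face.map_monotone {m n : ℕ} (α : Fin (m + 1) → Fin (n + 1)) : Monotone (Face.map α) :=
  fun _ _ h => Finset.image_mono α h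

theorem Face.map_injective {m n : ℕ} {α : Fin (m + 1) → Fin (n + 1)}
    (hα : Function.Injective α) : Function.Injective (Face.map α) :=
  fun _ _ h => Subtype.ext (Finset.image_injective hα (congrArg Subtype.val h))

/-- The affine combination of barycentres of faces with given weights. -/
def barycenter {n : ℕ} (w : Face n → ℝ) : Fin (n + 1) → ℝ :=
  fun k => ∑ S, w S * if k ∈ S.1 then (S.1.card : ℝ)⁻¹ else 0

theorem barycenter_nonneg {n : ℕ} {w : Face n → ℝ} (hw : ∀ S, 0 ≤ w S) (k : Fin (n + 1)) :
    0 ≤ barycenter w k :=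
  Finset.sum_nonneg fun S _ => mul_nonneg (hw S) (by split_ifs <;> positivity)

theorem sum_barycenter {n : ℕ} (w : Face n → ℝ) : ∑ k, barycenter w k = ∑ S, w S := by
  simp only [barycenter]
  rw [Finset.sum_comm]
  refine Finset.sum_congr rfl fun S _ => ?_
  have : (S.1.card : ℝ) ≠ 0 := by exact_mod_cast S.2.card_pos.ne'
  rw [← Finset.mul_sum]
  simp [this]

theorem barycenter_pushWeight_map {m n : ℕ} {α : Fin (m + 1) → Fin (n + 1)}
    (hα : Function.Injective α) (w : Face m → ℝ) :
    barycenter (pushWeight (Face.map α) w) = pushWeight α (barycenter w) := by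
  classical
  funext k
  have key : ∀ (S : Finset (Fin (m + 1))) (c : ℝ),
      (∑ i, if α i = k then (if i ∈ S then c else 0) else 0) = if k ∈ S.image α then c else 0 := by
    intro S c
    have h := Finset.sum_image (s := S) (g := α) (f := fun j => if j = k then c else 0) hα.injOn
    rw [Finset.sum_ite_eq'] at h
    rw [h, ← Finset.sum_filter_add_sum_filter_not Finset.univ (· ∈ S)]
    simp only [Finset.filter_univ_mem]
    rw [Finset.sum_congr rfl fun i (hi : i ∈ S) => by rw [if_pos hi], add_eq_left]
    refine Finset.sum_eq_zero fun i hi => ?_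
    simp [(Finset.mem_filter.1 hi).2]
  simp only [barycenter, sum_pushWeight_mul]
  have hr : pushWeight α (fun i => ∑ S : Face m, w S * if i ∈ S.1 then (S.1.card : ℝ)⁻¹ else 0) k =
      ∑ S : Face m, w S *
        ∑ i, if α i = k then (if i ∈ S.1 then (S.1.card : ℝ)⁻¹ else 0) else 0 := by
    simp only [pushWeight, Finset.mul_sum]
    rw [Finset.sum_comm]
    refine Finset.sum_congr rfl fun i _ => ?_
    by_cases h : α i = k <;> simp [h]
  change _ = pushWeight α (fun i => ∑ S : Face m, w S * if i ∈ S.1 then (S.1.card : ℝ)⁻¹ else 0) k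
  rw [hr]
  simp only [key]
  simp [Face.map, Finset.card_image_of_injective _ hα]

theorem continuous_barycenter {n : ℕ} : Continuous (barycenter (n := n)) :=
  continuous_pi fun _ => continuous_finsetSum _ fun S _ => (continuous_apply S).mul continuous_const

theorem barycenter_injOn {n : ℕ} : Set.InjOn (barycenter (n := n)) (chainWeights (Face n)) := by
  intro w hw w' hw' h
  by_contra hne
  obtain ⟨S₀, hS₀⟩ := Function.ne_iff.1 hne
  obtain ⟨S, hS, hmax⟩ := Finset.exists_max_image (Finset.univ.filter fun S => w S ≠ w' S)
    (fun S : Face n => S.1.card) ⟨S₀, by simpa using hS₀⟩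
  simp only [Finset.mem_filter, Finset.mem_univ, true_and] at hS hmax
  clear hne hS₀
  wlog hlt : w' S < w S generalizing w w'
  · exact this hw' hw h.symm hS.symm (fun T hT => hmax T hT.symm)
      (lt_of_le_of_ne (not_lt.1 hlt) hS)
  have cover : ∀ i ∈ S.1, ∃ T : Face n, i ∈ T.1 ∧ T ≠ S ∧ T.1.card ≤ S.1.card ∧ w' T ≠ 0 := by
    intro i hi
    by_contra! hno
    have hpos : 0 < ∑ T : Face n, (w T - w' T) * if i ∈ T.1 then (T.1.card : ℝ)⁻¹ else 0 := by
      refine Finset.sum_pos' (fun T _ => ?_) ⟨S, Finset.mem_univ _, ?_⟩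
      · split_ifs with hiT
        · refine mul_nonneg ?_ (by positivity)
          by_cases hTS : T = S
          · rw [hTS]; linarith
          by_cases hc : T.1.card ≤ S.1.card
          · rw [hno T hiT hTS hc, sub_zero]
            exact hw.1 T
          · have : w T = w' T := by
              by_contra hT
              exact hc (hmax T hT)
            simp [this]
        · simp
      · rw [if_pos hi]
        exact mul_pos (by linarith) (inv_pos.2 (by exact_mod_cast S.2.card_pos))
    have := congrFun h i
    simp only [barycenter] at this
    simp only [sub_mul, Finset.sum_sub_distrib] at hpos
    linarith
  obtain ⟨i₀, hi₀⟩ := S.2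
  obtain ⟨T₁, -, hT₁⟩ := cover i₀ hi₀
  obtain ⟨T, hT, hTmax⟩ := Finset.exists_max_image
    (Finset.univ.filter fun T => T ≠ S ∧ T.1.card ≤ S.1.card ∧ w' T ≠ 0)
    (fun S : Face n => S.1.card) ⟨T₁, by simpa using hT₁⟩
  simp only [Finset.mem_filter, Finset.mem_univ, true_and] at hT hTmax
  refine hT.1 (Subtype.ext (Finset.eq_of_subset_of_card_le (fun i hi => ?_) hT.2.1).symm)
  obtain ⟨T', hiT', hT'⟩ := cover i hi
  rcases hw'.2.2 T' T hT'.2.2 hT.2.2 with hle | hle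
  · exact hle hiT'
  · rw [Finset.eq_of_subset_of_card_le hle (hTmax T' hT')]
    exact hiT'

theorem exists_layers {n : ℕ} (v : Fin (n + 1) → ℝ) (hv : ∀ i, 0 ≤ v i) :
    ∃ a : Face n → ℝ, (∀ S, 0 ≤ a S) ∧ (∀ S T, a S ≠ 0 → a T ≠ 0 → S ≤ T ∨ T ≤ S) ∧
      (∀ S, a S ≠ 0 → ∀ i ∈ S.1, v i ≠ 0) ∧ ∀ i, (∑ S, if i ∈ S.1 then a S else 0) = v i := by
  classical
  induction hN : (Finset.univ.filter fun i => v i ≠ 0).card using Nat.strong_induction_on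
    generalizing v with
  | _ N ih =>
  by_cases hne : (Finset.univ.filter fun i => v i ≠ 0).Nonempty
  swap
  · have hz : ∀ i, v i = 0 := by simpa [Finset.not_nonempty_iff_eq_empty,
      Finset.filter_eq_empty_iff] using hne
    exact ⟨0, by simp, by simp, by simp, by simp [hz]⟩
  let A : Face n := ⟨_, hne⟩
  have hA : ∀ i, i ∈ A.1 ↔ v i ≠ 0 := by simp [A]
  obtain ⟨k, hk, hmin⟩ := Finset.exists_min_image A.1 v A.2
  let v' : Fin (n + 1) → ℝ := fun i => v i - if i ∈ A.1 then v k else 0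
  have hv' : ∀ i, 0 ≤ v' i := fun i => by
    simp only [v']
    split_ifs with hi
    · linarith [hmin i hi]
    · simpa using hv i
  have hsub : ∀ i, v' i ≠ 0 → v i ≠ 0 := fun i hi hvi => by
    have : i ∉ A.1 := by simp [hA, hvi]
    simp [v', this, hvi] at hi
  have hvk : v k ≠ 0 := (hA k).1 hk
  have hlt : (Finset.univ.filter fun i => v' i ≠ 0).card < N := by
    rw [← hN]
    refine Finset.card_lt_card ⟨fun i hi => ?_, fun hss => ?_⟩
    · simpa using hsub i (by simpa using hi)
    · have := hss (x := k) (by simpa using hvk)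
      simp [v', hk] at this
  obtain ⟨a, ha0, hchain, hsupp, hsum⟩ := ih _ hlt v' hv' rfl
  have hle : ∀ S, a S ≠ 0 → S ≤ A := fun S hS i hi => (hA i).2 (hsub i (hsupp S hS i hi))
  refine ⟨fun S => a S + if S = A then v k else 0, fun S => ?_, fun S T hS hT => ?_,
    fun S hS i hi => ?_, fun i => ?_⟩
  · have := ha0 S
    have := hv k
    dsimp only
    split_ifs <;> linarith
  · by_cases hSA : S = A
    · by_cases hTA : T = A
      · exact Or.inl (by rw [hSA, hTA])
      · exact Or.inr (hSA ▸ hle T (by simpa [hTA] using hT))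
    · by_cases hTA : T = A
      · exact Or.inl (hTA ▸ hle S (by simpa [hSA] using hS))
      · exact hchain S T (by simpa [hSA] using hS) (by simpa [hTA] using hT)
  · by_cases hSA : S = A
    · exact (hA i).1 (hSA ▸ hi)
    · exact hsub i (hsupp S (by simpa [hSA] using hS) i hi)
  · have : ∀ S : Face n, (if i ∈ S.1 then a S + (if S = A then v k else 0) else 0) =
        (if i ∈ S.1 then a S else 0) + if S = A then (if i ∈ A.1 then v k else 0) else 0 := by
      intro S
      by_cases hSA : S = A
      · subst hSA; by_cases hi : i ∈ A.1 <;> simp [hi]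
      · simp [hSA]
    simp only [this, Finset.sum_add_distrib, hsum, Finset.sum_ite_eq', Finset.mem_univ, if_true, v']
    ring

theorem exists_barycenter_eq {n : ℕ} (v : topStdSimplex n) :
    ∃ w ∈ chainWeights (Face n), barycenter w = v.1 := by
  obtain ⟨a, ha0, hchain, -, hsum⟩ := exists_layers v.1 v.2.1
  have hcard : ∀ S : Face n, (S.1.card : ℝ) ≠ 0 := fun S => by exact_mod_cast S.2.card_pos.ne'
  have hb : barycenter (fun S => a S * S.1.card) = v.1 := by
    funext i
    rw [← hsum i]
    refine Finset.sum_congr rfl fun S _ => ?_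
    split_ifs
    · rw [mul_assoc, mul_inv_cancel₀ (hcard S), mul_one]
    · simp
  refine ⟨fun S => a S * S.1.card, ⟨fun S => mul_nonneg (ha0 S) (by positivity), ?_,
    fun S T hS hT => hchain S T (left_ne_zero_of_mul hS) (left_ne_zero_of_mul hT)⟩, hb⟩
  rw [← sum_barycenter, hb]
  exact v.2.2

/-- The barycentric subdivision of a simplex, as a homeomorphism. -/
def subdivision (n : ℕ) : chainWeights (Face n) ≃ₜ topStdSimplex n :=
  Continuous.homeoOfEquivCompactToT2
    (f := Equiv.ofBijective
      (fun w : chainWeights (Face n) => (⟨barycenter w.1, barycenter_nonneg w.2.1,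
        (sum_barycenter w.1).trans w.2.2.1⟩ : topStdSimplex n))
      ⟨fun w w' h => Subtype.ext (barycenter_injOn w.2 w'.2 (congrArg Subtype.val h)), fun v =>
        have ⟨w, hw, h⟩ := exists_barycenter_eq v
        ⟨⟨w, hw⟩, Subtype.ext h⟩⟩)
    (Continuous.subtype_mk (continuous_barycenter.comp continuous_subtype_val) _)

theorem subdivision_val {n : ℕ} (w : chainWeights (Face n)) :
    (subdivision n w).1 = barycenter w.1 :=
  rfl

theorem subdivision_pushChain {m n : ℕ} (α : Fin (m + 1) →o Fin (n + 1))
    (hα : Function.Injective α) (w : chainWeights (Face m)) :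
    subdivision n (pushChain (Face.map_monotone α) w) = pushStd α (subdivision m w) := by
  apply Subtype.ext
  rw [subdivision_val, pushStd_val, subdivision_val]
  exact barycenter_pushWeight_map hα w.1

/-! ### Diagrams in the simplex category -/

namespace SimpObj

variable {X : SemiSimplicialSet.{u}} {a b d d' : SimpObj X}

theorem hom_injective (f : a ⟶ b) : Function.Injective f.1 :=
  f.2.choose

instance (f : a ⟶ b) : Mono f :=
  ⟨fun _ _ e => Subtype.ext <| OrderHom.ext _ _ <| funext fun i =>
    hom_injective f (congrArg (fun k => k.1 i) e)⟩

/-- The face of `d` spanned by a morphism to `d`. -/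
def rangeFace (f : a ⟶ d) : Face d.1 :=
  ⟨Finset.univ.image f.1, Finset.univ_nonempty.image _⟩

theorem coe_rangeFace (f : a ⟶ d) : ((rangeFace f).1 : Set (Fin (d.1 + 1))) = Set.range f.1 := by
  simp [rangeFace]

theorem rangeFace_comp (f : a ⟶ b) (g : b ⟶ d) :
    rangeFace (f ≫ g) = Face.map g.1 (rangeFace f) := by
  refine Subtype.ext ?_
  simp only [rangeFace, Face.map, Finset.image_image]
  rfl

theorem rangeFace_comp_le (f : a ⟶ b) (g : b ⟶ d) : rangeFace (f ≫ g) ≤ rangeFace g := by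
  intro i hi
  obtain ⟨k, -, rfl⟩ := Finset.mem_image.1 hi
  exact Finset.mem_image.2 ⟨f.1 k, Finset.mem_univ _, rfl⟩

theorem exists_lift {f : a ⟶ d} {g : b ⟶ d} (h : rangeFace f ≤ rangeFace g) :
    ∃ k : a ⟶ b, k ≫ g = f := by
  have h' : ∀ i, ∃ j, g.1 j = f.1 i := fun i => by
    obtain ⟨j, -, hj⟩ := Finset.mem_image.1
      (h (Finset.mem_image.2 ⟨i, Finset.mem_univ _, rfl⟩ : f.1 i ∈ (rangeFace f).1))
    exact ⟨j, hj⟩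
  choose k hk using h'
  have hg := g.1.monotone.strictMono_of_injective (hom_injective g)
  have hmono : Monotone k := fun i j hij => by
    rw [← hg.le_iff_le, hk, hk]
    exact f.1.monotone hij
  have hinj : Function.Injective k := fun i j hij =>
    hom_injective f (by rw [← hk, ← hk, hij])
  have hcomp : g.1.comp ⟨k, hmono⟩ = f.1 := OrderHom.ext _ _ (funext hk)
  obtain ⟨hg₁, hg₂⟩ := g.2
  obtain ⟨hf₁, hf₂⟩ := f.2
  refine ⟨⟨⟨k, hmono⟩, hinj, ?_⟩, Subtype.ext hcomp⟩
  rw [← hg₂, X.map_comp _ _ _ _ (hg₁.comp hinj), ← hf₂]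
  congr 1

theorem exists_eqToHom_comp {f : a ⟶ d} {g : b ⟶ d} (h : rangeFace f = rangeFace g) :
    ∃ e : a = b, eqToHom e ≫ g = f := by
  have hr : Set.range f.1 = Set.range g.1 := by rw [← coe_rangeFace, h, coe_rangeFace]
  obtain ⟨m, x⟩ := a
  obtain ⟨n, y⟩ := b
  obtain rfl : m = n := by
    have := congrArg Set.ncard hr
    rw [Set.ncard_range_of_injective (hom_injective f),
      Set.ncard_range_of_injective (hom_injective g)] at this
    simpa using this
  obtain ⟨f, hf, hf'⟩ := f
  obtain ⟨g, hg, hg'⟩ := g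
  obtain rfl : f = g := OrderHom.ext _ _
    (((f.monotone.strictMono_of_injective hf).range_inj
      (g.monotone.strictMono_of_injective hg)).1 hr)
  obtain rfl : x = y := hf'.symm.trans hg'
  exact ⟨rfl, Category.id_comp _⟩

variable {J : Type*} [PartialOrder J]

theorem functor_eq_of_rangeFace {F G : J ⥤ SimpObj X} (κ : F ⟶ (Functor.const J).obj d)
    (τ : G ⟶ (Functor.const J).obj d) (h : ∀ j, rangeFace (κ.app j) = rangeFace (τ.app j)) :
    F = G := by
  have hκ : ∀ {i j : J} (k : i ⟶ j), F.map k ≫ κ.app j = κ.app i := fun k => by simp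
  have hτ : ∀ {i j : J} (k : i ⟶ j), G.map k ≫ τ.app j = τ.app i := fun k => by simp
  choose e he using fun j => exists_eqToHom_comp (h j)
  have he' : ∀ j, eqToHom (e j).symm ≫ κ.app j = τ.app j := fun j => by
    rw [← he j, eqToHom_trans_assoc, eqToHom_refl, Category.id_comp]
  refine CategoryTheory.Functor.ext e fun i j k => ?_
  have : Mono (κ.app j) := inferInstanceAs (Mono (show F.obj j ⟶ d from κ.app j))
  rw [← cancel_mono (κ.app j)]
  simp only [Category.assoc]
  rw [hκ k, he' j, hτ k, he i]

/-- The monotone family of faces of `d` determined by a diagram over `d`. -/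
def faces {F : J ⥤ SimpObj X} (κ : F ⟶ (Functor.const J).obj d) : J →o Face d.1 where
  toFun j := rangeFace (κ.app j)
  monotone' i j h := by
    have := κ.naturality (homOfLE h)
    simp only [Functor.const_obj_map] at this
    exact (congrArg rangeFace this).symm.le.trans (rangeFace_comp_le _ _)

/-- The inclusion of the vertices of a face. -/
def faceEmb {n : ℕ} (S : Face n) : Fin (S.1.card - 1 + 1) →o Fin (n + 1) :=
  (S.1.orderEmbOfFin (Nat.sub_add_cancel S.2.card_pos).symm).toOrderHom

theorem faceEmb_injective {n : ℕ} (S : Face n) : Function.Injective (faceEmb S) :=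
  (S.1.orderEmbOfFin (Nat.sub_add_cancel S.2.card_pos).symm).injective

/-- A face of a simplex, as an object of the simplex category. -/
def face (d : SimpObj X) (S : Face d.1) : SimpObj X :=
  ⟨S.1.card - 1, X.map (faceEmb S) (faceEmb_injective S) d.2⟩

/-- The inclusion of a face. -/
def faceHom (d : SimpObj X) (S : Face d.1) : face d S ⟶ d :=
  ⟨faceEmb S, faceEmb_injective S, rfl⟩

theorem rangeFace_faceHom (S : Face d.1) : rangeFace (faceHom d S) = S := by
  refine Subtype.ext (Finset.coe_injective ?_)
  rw [coe_rangeFace]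
  exact Finset.range_orderEmbOfFin S.1 (Nat.sub_add_cancel S.2.card_pos).symm

theorem exists_faceHom_lift {S T : Face d.1} (h : S ≤ T) :
    ∃ k : face d S ⟶ face d T, k ≫ faceHom d T = faceHom d S :=
  exists_lift (by rwa [rangeFace_faceHom, rangeFace_faceHom])

/-- The diagram of all faces of an object of the simplex category. -/
def faceFunctor (d : SimpObj X) : Face d.1 ⥤ SimpObj X where
  obj := face d
  map k := (exists_faceHom_lift (leOfHom k)).choose
  map_id S := (cancel_mono (faceHom d S)).1 (by
    rw [(exists_faceHom_lift (leOfHom (𝟙 S))).choose_spec, Category.id_comp])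
  map_comp {S T U} f g := (cancel_mono (faceHom d U)).1 (by
    rw [Category.assoc, (exists_faceHom_lift (leOfHom g)).choose_spec,
      (exists_faceHom_lift (leOfHom f)).choose_spec,
      (exists_faceHom_lift (leOfHom (f ≫ g))).choose_spec])

/-- The inclusions of all faces. -/
def faceTrans (d : SimpObj X) : faceFunctor d ⟶ (Functor.const (Face d.1)).obj d where
  app := faceHom d
  naturality S T k := by
    exact (exists_faceHom_lift (leOfHom k)).choose_spec.trans (Category.comp_id _).symm

theorem eq_faces_comp_faceFunctor {F : J ⥤ SimpObj X} (κ : F ⟶ (Functor.const J).obj d) :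
    F = (faces κ).monotone.functor ⋙ faceFunctor d :=
  functor_eq_of_rangeFace κ (Functor.whiskerLeft (faces κ).monotone.functor (faceTrans d))
    fun _ => (rangeFace_faceHom _).symm

theorem faceFunctor_eq_map_comp (α : d' ⟶ d) :
    faceFunctor d' = (Face.map_monotone α.1).functor ⋙ faceFunctor d :=
  functor_eq_of_rangeFace (faceTrans d' ≫ (Functor.const _).map α)
    (Functor.whiskerLeft (Face.map_monotone α.1).functor (faceTrans d)) fun S => by
      refine (rangeFace_comp (faceHom d' S) α).trans ?_
      rw [rangeFace_faceHom]
      exact (rangeFace_faceHom _).symm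

/-- The morphisms from the vertices of a string of arrows to its last vertex. -/
def lastTrans {n : ℕ} (c : ComposableArrows (SimpObj X) n) :
    c ⟶ (Functor.const (Fin (n + 1))).obj (c.obj (Fin.last n)) where
  app i := c.map (homOfLE (Fin.le_last i))
  naturality i j k := by
    simp only [Functor.const_obj_obj, Functor.const_obj_map, Category.comp_id, ← c.map_comp]
    rfl

theorem faces_eq_map_faces_lastTrans {n : ℕ} {c : ComposableArrows (SimpObj X) n}
    (κ : c ⟶ (Functor.const (Fin (n + 1))).obj d) (i : Fin (n + 1)) :
    faces κ i = Face.map (κ.app (Fin.last n)).1 (faces (lastTrans c) i) := by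
  have h := κ.naturality (homOfLE (Fin.le_last i))
  simp only [Functor.const_obj_map] at h
  exact (congrArg rangeFace h).symm.trans (rangeFace_comp _ _)

end SimpObj

/-! ### Doubling of weights -/

section doubling

variable {J L J' L' : Type*}

/-- The graph of a map, inside the lexicographic product with the chain `L` with a top element. -/
def lexGraph (g : L → J) (i : L) : J ×ₗ WithTop L :=
  toLex (g i, (i : WithTop L))

/-- The section of the first projection at the top element. -/
def lexTop (j : J) : J ×ₗ WithTop L :=
  toLex (j, ⊤)

/-- The product of two maps, on lexicographic products. -/
def lexMap (β : J' → J) (φ : L' → L) (a : J' ×ₗ WithTop L') : J ×ₗ WithTop L :=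
  toLex (β (ofLex a).1, (ofLex a).2.map φ)

theorem lexGraph_injective (g : L → J) : Function.Injective (lexGraph g) :=
  fun _ _ h => WithTop.coe_injective (congrArg (fun a => (ofLex a).2) h)

theorem lexTop_injective : Function.Injective (lexTop : J → J ×ₗ WithTop L) :=
  fun _ _ h => congrArg (fun a => (ofLex a).1) h

theorem lexMap_injective {β : J' → J} {φ : L' → L} (hβ : Function.Injective β)
    (hφ : Function.Injective φ) : Function.Injective (lexMap β φ) := by
  intro a b h
  have h₁ := hβ (congrArg (fun a => (ofLex a).1) h)
  have h₂ := WithTop.map_injective hφ (congrArg (fun a => (ofLex a).2) h)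
  exact ofLex.injective (Prod.ext h₁ h₂)

section order

variable [PartialOrder J] [LinearOrder L] [PartialOrder J'] [LinearOrder L']

theorem monotone_lexFst : Monotone fun a : J ×ₗ WithTop L => (ofLex a).1 :=
  Prod.Lex.monotone_fst_ofLex

theorem monotone_lexGraph {g : L → J} (hg : Monotone g) : Monotone (lexGraph g) :=
  fun _ _ h => Prod.Lex.toLex_le_toLex'.2 ⟨hg h, fun _ => WithTop.coe_le_coe.2 h⟩

theorem monotone_lexTop : Monotone (lexTop : J → J ×ₗ WithTop L) :=
  fun _ _ h => Prod.Lex.toLex_le_toLex'.2 ⟨h, fun _ => le_rfl⟩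

theorem monotone_lexMap {β : J' → J} {φ : L' → L} (hβ : Monotone β) (hβ' : Function.Injective β)
    (hφ : Monotone φ) : Monotone (lexMap β φ) := by
  intro a b h
  obtain ⟨h₁, h₂⟩ := Prod.Lex.le_iff'.1 h
  exact Prod.Lex.toLex_le_toLex'.2 ⟨hβ h₁, fun e => hφ.withTop_map (h₂ (hβ' e))⟩

end order

variable [Fintype L]

/-- The weight obtained from the pushforward of `w` along `g` by moving the fraction `t` of the
weight to a new vertex after each fibre of `g`. -/
def doubledWeight (g : L → J) (w : L → ℝ) (t : ℝ) : J ×ₗ WithTop L → ℝ :=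
  fun a => (1 - t) * pushWeight (lexGraph g) w a + t * pushWeight (lexTop ∘ g) w a

theorem pushWeight_doubledWeight [Fintype J] {K : Type*} (ψ : J ×ₗ WithTop L → K) (g : L → J) (w : L → ℝ)
    (t : ℝ) : pushWeight ψ (doubledWeight g w t) = fun k =>
      (1 - t) * pushWeight (ψ ∘ lexGraph g) w k + t * pushWeight (ψ ∘ lexTop ∘ g) w k := by
  unfold doubledWeight
  rw [pushWeight_combination, pushWeight_pushWeight, pushWeight_pushWeight]

theorem pushWeight_fst_doubledWeight [Fintype J] (g : L → J) (w : L → ℝ) (t : ℝ) :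
    pushWeight (fun a => (ofLex a).1) (doubledWeight g w t) = pushWeight g w := by
  rw [pushWeight_doubledWeight]
  funext k
  change (1 - t) * pushWeight g w k + t * pushWeight g w k = _
  ring

theorem pushWeight_lexMap_doubledWeight [Fintype J'] [Fintype L'] {β : J' → J} {φ : L' → L} {g' : L' → J'} {g : L → J}
    (h : g ∘ φ = β ∘ g') (w : L' → ℝ) (t : ℝ) :
    pushWeight (lexMap β φ) (doubledWeight g' w t) = doubledWeight g (pushWeight φ w) t := by
  have h₁ : lexMap β φ ∘ lexGraph g' = lexGraph g ∘ φ := funext fun i =>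
    congrArg (fun b => toLex (b, (φ i : WithTop L))) (congrFun h i).symm
  have h₂ : lexMap β φ ∘ lexTop ∘ g' = (lexTop (L := L) ∘ g) ∘ φ := funext fun i =>
    congrArg (fun b => toLex (b, (⊤ : WithTop L))) (congrFun h i).symm
  rw [pushWeight_doubledWeight, h₁, h₂]
  unfold doubledWeight
  rw [pushWeight_pushWeight, pushWeight_pushWeight]

variable [Fintype J] [PartialOrder J] [LinearOrder L]

theorem doubledWeight_mem_chainWeights {g : L → J} (hg : Monotone g) (w : chainWeights L) (t : I) :
    doubledWeight g w.1 t ∈ chainWeights (J ×ₗ WithTop L) := by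
  have hsupp : ∀ a, doubledWeight g w.1 t a ≠ 0 → ∃ i, g i = (ofLex a).1 := by
    intro a ha
    by_contra! hno
    refine ha ?_
    have h₁ : pushWeight (lexGraph g) w.1 a = 0 := by
      by_contra hne
      obtain ⟨i, rfl, -⟩ := exists_of_pushWeight_ne_zero hne
      exact hno i rfl
    have h₂ : pushWeight (lexTop ∘ g) w.1 a = 0 := by
      by_contra hne
      obtain ⟨i, rfl, -⟩ := exists_of_pushWeight_ne_zero hne
      exact hno i rfl
    simp [doubledWeight, h₁, h₂]
  refine ⟨fun a => ?_, ?_, fun a b ha hb => ?_⟩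
  · exact add_nonneg (mul_nonneg (sub_nonneg.2 t.2.2) (pushWeight_nonneg _ w.2.1 a))
      (mul_nonneg t.2.1 (pushWeight_nonneg _ w.2.1 a))
  · simp only [doubledWeight, Finset.sum_add_distrib, ← Finset.mul_sum, sum_pushWeight, w.2.2.1]
    ring
  · obtain ⟨i, hi⟩ := hsupp a ha
    obtain ⟨j, hj⟩ := hsupp b hb
    simp only [Prod.Lex.le_iff', ← hi, ← hj]
    rcases eq_or_ne (g i) (g j) with h | h
    · rcases le_total (ofLex a).2 (ofLex b).2 with h' | h'
      · exact Or.inl ⟨h.le, fun _ => h'⟩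
      · exact Or.inr ⟨h.ge, fun _ => h'⟩
    · rcases le_total i j with h' | h'
      · exact Or.inl ⟨hg h', fun e => (h e).elim⟩
      · exact Or.inr ⟨hg h', fun e => (h e.symm).elim⟩

/-- The weights `doubledWeight`, as chain weights. -/
def doubledChain {g : L → J} (hg : Monotone g) (w : chainWeights L) (t : I) :
    chainWeights (J ×ₗ WithTop L) :=
  ⟨doubledWeight g w.1 t, doubledWeight_mem_chainWeights hg w t⟩

theorem continuous_doubledChain {g : L → J} (hg : Monotone g) :
    Continuous fun p : chainWeights L × I => doubledChain hg p.1 p.2 := by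
  refine Continuous.subtype_mk (continuous_pi fun a => ?_) _
  have h (ψ : L → J ×ₗ WithTop L) :
      Continuous fun p : chainWeights L × I => pushWeight ψ p.1.1 a :=
    (continuous_apply a).comp
      ((continuous_pushWeight ψ).comp (continuous_subtype_val.comp continuous_fst))
  have ht : Continuous fun p : chainWeights L × I => (p.2 : ℝ) :=
    continuous_subtype_val.comp continuous_snd
  exact ((continuous_const.sub ht).mul (h _)).add (ht.mul (h _))

end doubling

/-! ### The comparison map, its section and the homotopy -/

namespace SimpObj

variable {X : SemiSimplicialSet.{u}}

/-- A simplex, as an object of the simplex category. -/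
def ofSimplex {n : ℕ} (x : X.obj n) : SimpObj X :=
  ⟨n, x⟩

/-- The point of the realisation with given barycentric coordinates in a simplex. -/
def realPoint (d : SimpObj X) (v : topStdSimplex d.1) : FatRealization X :=
  Quot.mk _ ⟨d.1, (d.2, v)⟩

theorem continuous_realPoint (d : SimpObj X) : Continuous (realPoint d) :=
  continuous_fatRealization_mk X d.2

theorem realPoint_pushStd {d' d : SimpObj X} (α : d' ⟶ d) (v : topStdSimplex d'.1) :
    realPoint d (pushStd α.1 v) = realPoint d' v := by
  obtain ⟨hα, h⟩ := α.2
  have := Quot.sound (FatRel.glue α.1 hα d.2 v)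
  rw [h] at this
  exact this.symm

/-- The point of the realisation attached to a diagram over `d` and a weight on it. -/
def overPoint {J : Type*} [Fintype J] [PartialOrder J] {F : J ⥤ SimpObj X} {d : SimpObj X}
    (κ : F ⟶ (Functor.const J).obj d) (w : chainWeights J) : FatRealization X :=
  realPoint d (subdivision d.1 (pushChain (faces κ).monotone w))

theorem overPoint_eq_lastTrans {n : ℕ} {c : ComposableArrows (SimpObj X) n} {d : SimpObj X}
    (κ : c ⟶ (Functor.const (Fin (n + 1))).obj d) (w : chainWeights (Fin (n + 1))) :
    overPoint κ w = overPoint (lastTrans c) w := by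
  unfold overPoint
  rw [← realPoint_pushStd (κ.app (Fin.last n)), ← subdivision_pushChain _ (hom_injective _),
    pushChain_pushChain]
  congr 2
  apply Subtype.ext
  exact congrArg (fun g => pushWeight g w.1) (funext (faces_eq_map_faces_lastTrans κ))

theorem overPoint_whiskerLeft {J K : Type*} [Fintype J] [PartialOrder J] [Fintype K]
    [PartialOrder K] {F : K ⥤ SimpObj X} {d : SimpObj X} (κ : F ⟶ (Functor.const K).obj d)
    {g : J → K} (hg : Monotone g) (w : chainWeights J) :
    overPoint (d := d) (Functor.whiskerLeft hg.functor κ) w = overPoint κ (pushChain hg w) := by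
  unfold overPoint
  rw [pushChain_pushChain]
  rfl

theorem continuous_overPoint {J : Type*} [Fintype J] [PartialOrder J] {F : J ⥤ SimpObj X}
    {d : SimpObj X} (κ : F ⟶ (Functor.const J).obj d) : Continuous (overPoint κ) :=
  (continuous_realPoint d).comp
    ((subdivision d.1).continuous.comp (continuous_pushChain (faces κ).monotone))

/-- The map `B Simp(X) → ‖X‖` sending the vertices of the nerve to barycentres. -/
def toReal (X : SemiSimplicialSet.{u}) : ClassifyingSpace (SimpObj X) → FatRealization X :=
  Quot.lift (fun p => overPoint (lastTrans p.2.1) (vertexWeights p.2.2)) (by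
    rintro _ _ ⟨φ, hφ, c, v⟩
    exact (overPoint_eq_lastTrans (Functor.whiskerLeft φ.monotone.functor (lastTrans c))
      (vertexWeights v)).symm.trans ((overPoint_whiskerLeft _ _ _).trans
        (congrArg _ (vertexWeights_pushStd φ v).symm)))

theorem continuous_toReal : Continuous (toReal X) :=
  continuous_fatRealization_lift _ fun _ c =>
    (continuous_overPoint (lastTrans c)).comp continuous_vertexWeights

theorem toReal_weightPoint {J : Type*} [Fintype J] [PartialOrder J] {F : J ⥤ SimpObj X}
    {d : SimpObj X} (κ : F ⟶ (Functor.const J).obj d) (w : chainWeights J) :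
    toReal X (weightPoint F w) = overPoint κ w := by
  obtain ⟨n, g, v, hg, -, hv⟩ := exists_pushWeight_eq w.2
  rw [weightPoint_eq_nervePoint F w g hg v hv.symm]
  refine (overPoint_eq_lastTrans (Functor.whiskerLeft g.monotone.functor κ)
    (vertexWeights v)).symm.trans ((overPoint_whiskerLeft _ _ _).trans ?_)
  congr 1
  exact Subtype.ext hv

theorem overPoint_faceTrans (d : SimpObj X) (w : chainWeights (Face d.1)) :
    overPoint (faceTrans d) w = realPoint d (subdivision d.1 w) := by
  unfold overPoint
  congr 2
  apply Subtype.ext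
  exact (congrArg (fun g => pushWeight g w.1) (funext rangeFace_faceHom)).trans (pushWeight_id _)

/-- The map `‖X‖ → B Simp(X)` given by barycentric subdivision. -/
def ofReal (X : SemiSimplicialSet.{u}) : FatRealization X → ClassifyingSpace (SimpObj X) :=
  Quot.lift (fun p => weightPoint (faceFunctor (ofSimplex p.2.1))
    ((subdivision p.1).symm p.2.2)) (by
    rintro _ _ ⟨φ, hφ, x, v⟩
    let α : ofSimplex (X.map φ hφ x) ⟶ ofSimplex x := ⟨φ, hφ, rfl⟩
    dsimp only
    rw [faceFunctor_eq_map_comp α]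
    refine (weightPoint_pushWeight _ _ (Face.map_injective hφ) _ _ ?_).symm
    obtain ⟨w, rfl⟩ := (subdivision _).surjective v
    rw [← subdivision_pushChain φ hφ, Homeomorph.symm_apply_apply, Homeomorph.symm_apply_apply]
    rfl)

theorem continuous_ofReal : Continuous (ofReal X) :=
  continuous_fatRealization_lift _ fun n x =>
    (continuous_weightPoint (faceFunctor (ofSimplex x))).comp (subdivision n).symm.continuous

theorem ofReal_realPoint (d : SimpObj X) (w : chainWeights (Face d.1)) :
    ofReal X (realPoint d (subdivision d.1 w)) = weightPoint (faceFunctor d) w :=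
  congrArg (weightPoint (faceFunctor d)) ((subdivision d.1).symm_apply_apply w)

theorem exists_realPoint_eq (z : FatRealization X) :
    ∃ (d : SimpObj X) (w : chainWeights (Face d.1)), realPoint d (subdivision d.1 w) = z := by
  obtain ⟨⟨n, x, v⟩, rfl⟩ := Quot.exists_rep z
  obtain ⟨w, rfl⟩ := (subdivision n).surjective v
  exact ⟨ofSimplex x, w, rfl⟩

theorem toReal_ofReal (z : FatRealization X) : toReal X (ofReal X z) = z := by
  obtain ⟨d, w, rfl⟩ := exists_realPoint_eq z
  rw [ofReal_realPoint, toReal_weightPoint (faceTrans d), overPoint_faceTrans]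

/-- The homotopy from the identity of `B Simp(X)` to the projection onto the image of `‖X‖`, on a
diagram over `d`. -/
def overHomotopy {L : Type*} [Fintype L] [LinearOrder L] {F : L ⥤ SimpObj X} {d : SimpObj X}
    (κ : F ⟶ (Functor.const L).obj d) (w : chainWeights L) (t : I) :
    ClassifyingSpace (SimpObj X) :=
  weightPoint (monotone_lexFst.functor ⋙ faceFunctor d) (doubledChain (faces κ).monotone w t)

theorem overHomotopy_eq_lastTrans {n : ℕ} {c : ComposableArrows (SimpObj X) n} {d : SimpObj X}
    (κ : c ⟶ (Functor.const (Fin (n + 1))).obj d) (w : chainWeights (Fin (n + 1))) (t : I) :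
    overHomotopy κ w t = overHomotopy (lastTrans c) w t := by
  have hα := hom_injective (κ.app (Fin.last n))
  unfold overHomotopy
  rw [faceFunctor_eq_map_comp (κ.app (Fin.last n))]
  refine weightPoint_pushWeight _
    (monotone_lexMap (Face.map_monotone _) (Face.map_injective hα) monotone_id)
    (lexMap_injective (Face.map_injective hα) Function.injective_id) _ _ ?_
  refine Eq.trans ?_ (pushWeight_lexMap_doubledWeight
    (funext (faces_eq_map_faces_lastTrans κ)) _ _).symm
  rw [pushWeight_id]
  rfl

theorem overHomotopy_whiskerLeft {L L' : Type*} [Fintype L] [LinearOrder L] [Fintype L']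
    [LinearOrder L'] {F : L' ⥤ SimpObj X} {d : SimpObj X} (κ : F ⟶ (Functor.const L').obj d)
    {g : L → L'} (hg : Monotone g) (hg' : Function.Injective g) (w : chainWeights L) (t : I) :
    overHomotopy (d := d) (Functor.whiskerLeft hg.functor κ) w t =
      overHomotopy κ (pushChain hg w) t := by
  unfold overHomotopy
  refine (weightPoint_pushWeight (monotone_lexFst.functor ⋙ faceFunctor d)
    (monotone_lexMap monotone_id Function.injective_id hg)
    (lexMap_injective Function.injective_id hg') _ _ ?_).symm
  exact (pushWeight_lexMap_doubledWeight (β := id) (g' := faces κ ∘ g) (g := faces κ)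
    rfl w.1 t).symm

theorem continuous_overHomotopy {L : Type*} [Fintype L] [LinearOrder L] {F : L ⥤ SimpObj X}
    {d : SimpObj X} (κ : F ⟶ (Functor.const L).obj d) :
    Continuous fun p : chainWeights L × I => overHomotopy κ p.1 p.2 :=
  (continuous_weightPoint _).comp (continuous_doubledChain _)

/-- The homotopy on a string of arrows, as a map to the path space. -/
def overPath {L : Type*} [Fintype L] [LinearOrder L] {F : L ⥤ SimpObj X} {d : SimpObj X}
    (κ : F ⟶ (Functor.const L).obj d) : C(chainWeights L, C(I, ClassifyingSpace (SimpObj X))) :=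
  ContinuousMap.curry ⟨_, continuous_overHomotopy κ⟩

theorem overPath_lastTrans_pushStd {m n : ℕ} (c : ComposableArrows (SimpObj X) n)
    (φ : Fin (m + 1) →o Fin (n + 1)) (hφ : Function.Injective φ) (v : topStdSimplex m) :
    overPath (lastTrans (n := m) (φ.monotone.functor ⋙ c)) (vertexWeights v) =
      overPath (lastTrans c) (vertexWeights (pushStd φ v)) := by
  refine ContinuousMap.ext fun t => ?_
  change overHomotopy _ _ t = overHomotopy _ _ t
  rw [vertexWeights_pushStd, ← overHomotopy_whiskerLeft _ _ hφ]
  exact (overHomotopy_eq_lastTrans (Functor.whiskerLeft φ.monotone.functor (lastTrans c))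
    (vertexWeights v) t).symm

/-- The homotopy from the identity of `B Simp(X)` to the projection onto the image of `‖X‖`, as a
map to the path space. -/
def contraction (X : SemiSimplicialSet.{u}) :
    ClassifyingSpace (SimpObj X) → C(I, ClassifyingSpace (SimpObj X)) :=
  Quot.lift (fun p => overPath (lastTrans p.2.1) (vertexWeights p.2.2)) (by
    rintro _ _ ⟨φ, hφ, c, v⟩
    exact overPath_lastTrans_pushStd c φ hφ v)

theorem continuous_contraction : Continuous (contraction X) :=
  continuous_fatRealization_lift _ fun _ c =>
    (overPath (lastTrans c)).continuous.comp continuous_vertexWeights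

theorem contraction_zero (z : ClassifyingSpace (SimpObj X)) : contraction X z 0 = z := by
  obtain ⟨⟨n, c, v⟩, rfl⟩ := Quot.exists_rep z
  change overHomotopy (lastTrans c) (vertexWeights v) 0 = nervePoint c v
  conv_rhs => rw [eq_faces_comp_faceFunctor (lastTrans c)]
  refine weightPoint_eq_nervePoint _ _
    ⟨lexGraph (faces (lastTrans c)), monotone_lexGraph (faces (lastTrans c)).monotone⟩
    (lexGraph_injective _) v ?_
  funext a
  simp [doubledChain, doubledWeight]
  rfl

theorem overHomotopy_one {L : Type*} [Fintype L] [LinearOrder L] {F : L ⥤ SimpObj X}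
    {d : SimpObj X} (κ : F ⟶ (Functor.const L).obj d) (w : chainWeights L) :
    overHomotopy κ w 1 = weightPoint (faceFunctor d) (pushChain (faces κ).monotone w) := by
  refine weightPoint_pushWeight (monotone_lexFst.functor ⋙ faceFunctor d)
    (monotone_lexTop (J := Face d.1) (L := L)) lexTop_injective _ _ ?_
  change doubledWeight _ _ _ = pushWeight _ (pushWeight _ _)
  rw [pushWeight_pushWeight]
  funext a
  simp [doubledWeight]

theorem contraction_one (z : ClassifyingSpace (SimpObj X)) :
    contraction X z 1 = ofReal X (toReal X z) := by
  obtain ⟨⟨n, c, v⟩, rfl⟩ := Quot.exists_rep z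
  exact (overHomotopy_one (lastTrans c) (vertexWeights v)).trans (ofReal_realPoint _ _).symm

theorem toReal_contraction (z : ClassifyingSpace (SimpObj X)) (t : I) :
    toReal X (contraction X z t) = toReal X z := by
  obtain ⟨⟨n, c, v⟩, rfl⟩ := Quot.exists_rep z
  refine (toReal_weightPoint (Functor.whiskerLeft monotone_lexFst.functor (faceTrans _)) _).trans ?_
  rw [overPoint_whiskerLeft, overPoint_faceTrans]
  change realPoint _ _ = realPoint _ _
  congr 2
  exact Subtype.ext (pushWeight_fst_doubledWeight _ _ _)

end SimpObj

/-! ### Weak equivalences from fibrewise contractions -/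

section collar

variable {N Y : Type*}

/-- Dilation of the cube about its centre, followed by the retraction to the cube. -/
def stretch (r : ℝ) (y : N → I) : N → I :=
  fun i => Set.projIcc 0 1 zero_le_one (1 / 2 + r * ((y i : ℝ) - 1 / 2))

theorem stretch_one (y : N → I) : stretch 1 y = y := by
  funext i
  have h : (1 : ℝ) / 2 + 1 * ((y i : ℝ) - 1 / 2) = y i := by ring
  rw [stretch, h, Set.projIcc_val]

theorem continuous_stretch : Continuous fun p : ℝ × (N → I) => stretch p.1 p.2 := by
  refine continuous_pi fun i => continuous_projIcc.comp ?_
  have h : Continuous fun p : ℝ × (N → I) => ((p.2 i : I) : ℝ) :=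
    continuous_subtype_val.comp ((continuous_apply i).comp continuous_snd)
  fun_prop

theorem projIcc_eq_zero_or_one {a : ℝ} (h : 1 / 2 ≤ |a|) :
    Set.projIcc (0 : ℝ) 1 zero_le_one (1 / 2 + a) = 0 ∨
      Set.projIcc (0 : ℝ) 1 zero_le_one (1 / 2 + a) = 1 := by
  rcases le_abs.1 h with h | h
  · exact Or.inr (Set.projIcc_of_right_le _ (by linarith))
  · exact Or.inl (Set.projIcc_of_le_left _ (by linarith))

theorem stretch_mem_boundary_of_mem {r : ℝ} (hr : 1 ≤ r) {y : N → I} (hy : y ∈ Cube.boundary N) :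
    stretch r y ∈ Cube.boundary N := by
  obtain ⟨i, hi⟩ := hy
  refine ⟨i, projIcc_eq_zero_or_one ?_⟩
  rcases hi with hi | hi
  · rw [hi, le_abs]
    right
    norm_num
    linarith
  · rw [hi, le_abs]
    left
    norm_num
    linarith

section homotopic

variable [TopologicalSpace Y]

theorem genLoop_homotopic_of {x : Y} {γ δ : GenLoop N Y x} {G : I → (N → I) → Y}
    (hG : Continuous fun p : I × (N → I) => G p.1 p.2) (h₀ : ∀ y, G 0 y = γ y)
    (h₁ : ∀ y, G 1 y = δ y) (hb : ∀ t, ∀ y ∈ Cube.boundary N, G t y = x) :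
    GenLoop.Homotopic γ δ :=
  ⟨{ toFun := fun p => G p.1 p.2
     continuous_toFun := hG
     map_zero_left := h₀
     map_one_left := h₁
     prop' := fun t y hy => (hb t y hy).trans (γ.2 y hy).symm }⟩

theorem homotopic_of_eq_stretch {x : Y} {γ δ : GenLoop N Y x} (h : ∀ y, δ y = γ (stretch 2 y)) :
    GenLoop.Homotopic γ δ := by
  refine genLoop_homotopic_of (G := fun t y => γ (stretch (1 + t) y)) ?_ (fun y => ?_) (fun y => ?_)
    fun t y hy => ?_
  · refine γ.1.continuous.comp (continuous_stretch.comp (Continuous.prodMk ?_ continuous_snd))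
    exact continuous_const.add (continuous_subtype_val.comp continuous_fst)
  · simp [stretch_one]
  · rw [h]
    norm_num
  · exact γ.2 _ (stretch_mem_boundary_of_mem (by linarith [t.2.1]) hy)

end homotopic

variable [Fintype N]

/-- The distance from the centre of the cube, normalised to be `1` on the boundary. -/
def cubeNorm (y : N → I) : ℝ :=
  ‖fun i => 2 * (y i : ℝ) - 1‖

theorem continuous_cubeNorm : Continuous (cubeNorm (N := N)) := by
  refine continuous_norm.comp (continuous_pi fun i => ?_)
  have h : Continuous fun y : N → I => ((y i : I) : ℝ) :=
    continuous_subtype_val.comp (continuous_apply i)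
  fun_prop

theorem cubeNorm_le_one (y : N → I) : cubeNorm y ≤ 1 :=
  (pi_norm_le_iff_of_nonneg zero_le_one).2 fun i =>
    abs_le.2 ⟨by linarith [(y i).2.1], by linarith [(y i).2.2]⟩

theorem cubeNorm_of_mem_boundary {y : N → I} (hy : y ∈ Cube.boundary N) : cubeNorm y = 1 := by
  refine le_antisymm (cubeNorm_le_one y) ?_
  obtain ⟨i, hi⟩ := hy
  refine le_trans ?_ (norm_le_pi_norm (fun i => 2 * (y i : ℝ) - 1) i)
  rcases hi with hi | hi <;> norm_num [hi]

theorem stretch_mem_boundary [Nonempty N] {r : ℝ} {y : N → I} (hr : 1 ≤ r * cubeNorm y) :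
    stretch r y ∈ Cube.boundary N := by
  obtain ⟨i, -, hi⟩ := Finset.exists_mem_eq_sup' Finset.univ_nonempty
    fun i => ‖2 * (y i : ℝ) - 1‖
  have hi' : cubeNorm y = ‖2 * (y i : ℝ) - 1‖ := by
    refine le_antisymm ?_ (norm_le_pi_norm (fun i => 2 * (y i : ℝ) - 1) i)
    refine (pi_norm_le_iff_of_nonneg (norm_nonneg _)).2 fun j => ?_
    rw [← hi]
    exact Finset.le_sup' (fun i => ‖2 * (y i : ℝ) - 1‖) (Finset.mem_univ j)
  refine ⟨i, projIcc_eq_zero_or_one ?_⟩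
  rw [hi', Real.norm_eq_abs] at hr
  have h₁ : r * (2 * (y i : ℝ) - 1) ≤ |r * (2 * (y i : ℝ) - 1)| := le_abs_self _
  have h₂ : r * |2 * (y i : ℝ) - 1| ≤ |r * (2 * (y i : ℝ) - 1)| := by
    rw [abs_mul]
    exact mul_le_mul_of_nonneg_right (le_abs_self r) (abs_nonneg _)
  have h₃ : r * ((y i : ℝ) - 1 / 2) = 1 / 2 * (r * (2 * (y i : ℝ) - 1)) := by ring
  rw [h₃, abs_mul, abs_of_pos (by norm_num : (0 : ℝ) < 1 / 2)]
  linarith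

/-- The map on the cube that is `e` on a smaller cube and follows `τ` on a collar. -/
def collar (e : (N → I) → Y) (τ : I → Y) (y : N → I) : Y :=
  if cubeNorm y ≤ 1 / 2 then e (stretch 2 y)
  else τ (Set.projIcc 0 1 zero_le_one (2 * cubeNorm y - 1))

theorem collar_of_mem_boundary (e : (N → I) → Y) (τ : I → Y) {y : N → I}
    (hy : y ∈ Cube.boundary N) : collar e τ y = τ 1 := by
  rw [collar, cubeNorm_of_mem_boundary hy, if_neg (by norm_num), Set.projIcc_of_right_le]
  · rfl
  · norm_num

variable [Nonempty N]

theorem collar_eq_stretch {e : (N → I) → Y} {τ : I → Y}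
    (h : ∀ s, ∀ y ∈ Cube.boundary N, e y = τ s) (y : N → I) :
    collar e τ y = e (stretch 2 y) := by
  unfold collar
  split_ifs with hy
  · rfl
  · exact (h _ _ (stretch_mem_boundary (by linarith))).symm

variable [TopologicalSpace Y]

theorem continuous_collar {A : Type*} [TopologicalSpace A] {E : A → (N → I) → Y} {T : A → I → Y}
    (hE : Continuous fun p : A × (N → I) => E p.1 p.2) (hT : Continuous fun p : A × I => T p.1 p.2)
    (h : ∀ a, ∀ y ∈ Cube.boundary N, E a y = T a 0) :
    Continuous fun p : A × (N → I) => collar (E p.1) (T p.1) p.2 := by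
  have hn : Continuous fun p : A × (N → I) => cubeNorm p.2 := continuous_cubeNorm.comp continuous_snd
  have hs : Continuous fun p : A × (N → I) =>
      Set.projIcc (0 : ℝ) 1 zero_le_one (2 * cubeNorm p.2 - 1) :=
    continuous_projIcc.comp ((continuous_const.mul hn).sub continuous_const)
  refine Continuous.if_le ?_ (hT.comp (continuous_fst.prodMk hs)) hn continuous_const fun p hp => ?_
  · exact hE.comp (continuous_fst.prodMk
      (continuous_stretch.comp (continuous_const.prodMk continuous_snd)))
  · rw [h _ _ (stretch_mem_boundary (by linarith)), Set.projIcc_of_le_left]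
    · rfl
    · linarith

/-- A collared map on the cube, as a generalised loop. -/
def collarLoop {x : Y} (e : C(N → I, Y)) (τ : C(I, Y)) (h : ∀ y ∈ Cube.boundary N, e y = τ 0)
    (hx : τ 1 = x) : GenLoop N Y x :=
  ⟨⟨collar e τ, (continuous_collar (A := Unit) (E := fun _ => e) (T := fun _ => τ)
      (e.continuous.comp continuous_snd) (τ.continuous.comp continuous_snd) fun _ => h).comp
      (Continuous.prodMk_right ())⟩, fun _ hy => (collar_of_mem_boundary _ _ hy).trans hx⟩

theorem homotopic_of_eq_collar {x : Y} {γ δ : GenLoop N Y x} {E : I → (N → I) → Y} {T : I → I → Y}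
    (hE : Continuous fun p : I × (N → I) => E p.1 p.2) (hT : Continuous fun p : I × I => T p.1 p.2)
    (h : ∀ t, ∀ y ∈ Cube.boundary N, E t y = T t 0) (hx : ∀ t, T t 1 = x)
    (h₀ : ∀ y, γ y = collar (E 0) (T 0) y) (h₁ : ∀ y, δ y = collar (E 1) (T 1) y) :
    GenLoop.Homotopic γ δ :=
  genLoop_homotopic_of (G := fun t => collar (E t) (T t)) (continuous_collar hE hT h)
    (fun y => (h₀ y).symm) (fun y => (h₁ y).symm)
    fun t _ hy => (collar_of_mem_boundary _ _ hy).trans (hx t)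

end collar

theorem isWeakHomotopyEquiv_id (Y : Type*) [TopologicalSpace Y] :
    IsWeakHomotopyEquiv (ContinuousMap.id Y) :=
  ⟨fun y => ⟨y, .refl y⟩, fun _ _ h => h, fun _ _ γ => ⟨γ, .refl _⟩, fun _ _ _ _ h => h⟩

/-- A retraction onto a section along a fibrewise homotopy is a weak homotopy equivalence. -/
theorem isWeakHomotopyEquiv_of_fibrewise {Y B : Type*} [TopologicalSpace Y] [TopologicalSpace B]
    (p : C(Y, B)) (s : C(B, Y)) {H : Y → I → Y} (hH : Continuous fun q : Y × I => H q.1 q.2)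
    (hs : ∀ b, p (s b) = b) (h₀ : ∀ z, H z 0 = z) (h₁ : ∀ z, H z 1 = s (p z))
    (hp : ∀ z t, p (H z t) = p z) : IsWeakHomotopyEquiv p := by
  have hx (x : Y) : Continuous (H x) := hH.comp (Continuous.prodMk_right x)
  let τ (x : Y) : C(I, Y) := ⟨fun t => H x (unitInterval.symm t), (hx x).comp continuous_symm⟩
  have hτ₀ (x : Y) : τ x 0 = s (p x) := by simp [τ, h₁]
  have hτ₁ (x : Y) : τ x 1 = x := by simp [τ, h₀]
  have hj (z : Y) : Joined z (s (p z)) := ⟨⟨⟨H z, hx z⟩, h₀ z, h₁ z⟩⟩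
  refine ⟨fun b => ⟨s b, by rw [hs]⟩, fun x₀ x₁ h => ?_, fun n x γ => ?_, fun n x δ₀ δ₁ h => ?_⟩
  · exact (hj x₀).trans ((h.map s.continuous).trans (hj x₁).symm)
  · have hγ : ∀ y ∈ Cube.boundary (Fin (n + 1)), s.comp γ.1 y = τ x 0 := fun y hy =>
      (congrArg s (γ.2 y hy)).trans (hτ₀ x).symm
    refine ⟨collarLoop (s.comp γ.1) (τ x) hγ (hτ₁ x), .symm (homotopic_of_eq_stretch fun y => ?_)⟩
    change p (collar _ _ y) = _
    unfold collar
    split_ifs with hy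
    · exact hs _
    · exact (hp _ _).trans (γ.2 _ (stretch_mem_boundary (by linarith))).symm
  · have hδ (δ : GenLoop (Fin (n + 1)) Y x) :
        ∀ y ∈ Cube.boundary (Fin (n + 1)), (s.comp p).comp δ.1 y = τ x 0 := fun y hy =>
      (congrArg (fun z => s (p z)) (δ.2 y hy)).trans (hτ₀ x).symm
    have key (δ : GenLoop (Fin (n + 1)) Y x) :
        GenLoop.Homotopic δ (collarLoop ((s.comp p).comp δ.1) (τ x) (hδ δ) (hτ₁ x)) := by
      have hc : ∀ y ∈ Cube.boundary (Fin (n + 1)), δ.1 y = ContinuousMap.const I x 0 := δ.2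
      refine (homotopic_of_eq_stretch (δ := collarLoop δ.1 (.const I x) hc rfl)
        (collar_eq_stretch fun _ => hc)).trans ?_
      refine homotopic_of_eq_collar (E := fun t y => H (δ y) t)
        (T := fun t r => H x (t * unitInterval.symm r)) ?_ ?_ ?_ ?_ ?_ ?_
      · exact hH.comp ((δ.1.continuous.comp continuous_snd).prodMk continuous_fst)
      · exact (hx x).comp (continuous_fst.mul (continuous_symm.comp continuous_snd))
      · intro t y hy
        rw [show δ y = x from δ.2 y hy]
        simp
      · simp [h₀]
      · intro y
        simp only [h₀, zero_mul]
        rfl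
      · intro y
        simp only [h₁, one_mul]
        rfl
    refine (key δ₀).trans (.trans ?_ (key δ₁).symm)
    obtain ⟨M⟩ := h
    refine homotopic_of_eq_collar (E := fun t y => s (M (t, y))) (T := fun _ => τ x)
      (s.continuous.comp M.continuous) ((τ x).continuous.comp continuous_snd) ?_
      (fun _ => hτ₁ x) ?_ ?_
    · intro t y hy
      rw [hτ₀, M.eq_fst t hy]
      exact congrArg s ((pushLoop p δ₀).2 y hy)
    · intro y
      simp only [ContinuousMap.HomotopyWith.apply_zero]
      rfl
    · intro y
      simp only [ContinuousMap.HomotopyWith.apply_one]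
      rfl

end

/-- There is a (natural) zig-zag of weak homotopy equivalences between the classifying space
`B Simp(X)` of the simplex category of a semi-simplicial set `X` and the fat geometric
realisation `‖X‖`. -/
theorem classifyingSpace_simpCat_weakEquiv_fatRealization (X : SemiSimplicialSet.{u}) :
    ∃ (Z : Type u) (_ : TopologicalSpace Z)
      (f : C(Z, ClassifyingSpace (SimpObj X))) (g : C(Z, FatRealization X)),
      IsWeakHomotopyEquiv f ∧ IsWeakHomotopyEquiv g := by
  refine ⟨ClassifyingSpace (SimpObj X), inferInstance, .id _,
    ⟨SimpObj.toReal X, SimpObj.continuous_toReal⟩, isWeakHomotopyEquiv_id _, ?_⟩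
  exact isWeakHomotopyEquiv_of_fibrewise _ ⟨SimpObj.ofReal X, SimpObj.continuous_ofReal⟩
    (H := fun z t => SimpObj.contraction X z t)
    (continuous_eval.comp (SimpObj.continuous_contraction.prodMap continuous_id))
    SimpObj.toReal_ofReal SimpObj.contraction_zero SimpObj.contraction_one SimpObj.toReal_contraction
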